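/- Let P be a positive counter-diagonal 3×3 real matrix. If C, D, C′, D′ are invertible diagonal 3×3 real matrices and f, f′ are positive real numbers such that C·P·D = C³_f and C′·P·D′ = C³_{f′}, then f = f′. In other words, the standard trigonal representative of the double coset Δ·P·Δ (Δ the invertible diagonal matrices) is unique. -/

import Mathlib

open Matrix

/-- A 3×3 real matrix is positive counter-diagonal if its diagonal entries vanish
and its off-diagonal entries are positive. -/
def IsPosCounterDiag (P : Matrix (Fin 3) (Fin 3) ℝ) : Prop :=
  (∀ i, P i i = 0) ∧ ∀ i j, i ≠ j → 0 < P i j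

/-- The standard trigonal matrix `C³_f`. -/
def stdTrigonal (f : ℝ) : Matrix (Fin 3) (Fin 3) ℝ :=
  !![0, f, 1; 1, 0, f; f, 1, 0]

/-- The quotient of the two cyclic products of the off-diagonal entries is invariant under
diagonal scaling; for `stdTrigonal f` it is `f ^ 3`. -/
lemma pow_three_mul_eq_of_diagonal_mul_mul_diagonal {P : Matrix (Fin 3) (Fin 3) ℝ}
    {c d : Fin 3 → ℝ} {f : ℝ}
    (h : Matrix.diagonal c * P * Matrix.diagonal d = stdTrigonal f) :
    f ^ 3 * (P 0 2 * P 1 0 * P 2 1) = P 0 1 * P 1 2 * P 2 0 := by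
  have entry (i j) : c i * P i j * d j = stdTrigonal f i j := by
    rw [← h, Matrix.mul_diagonal, Matrix.diagonal_mul]
  have h01 : c 0 * P 0 1 * d 1 = f := entry 0 1
  have h12 : c 1 * P 1 2 * d 2 = f := entry 1 2
  have h20 : c 2 * P 2 0 * d 0 = f := entry 2 0
  have h02 : c 0 * P 0 2 * d 2 = 1 := entry 0 2
  have h10 : c 1 * P 1 0 * d 0 = 1 := entry 1 0
  have h21 : c 2 * P 2 1 * d 1 = 1 := entry 2 1
  calc f ^ 3 * (P 0 2 * P 1 0 * P 2 1)
      = (c 0 * P 0 1 * d 1) * (c 1 * P 1 2 * d 2) * (c 2 * P 2 0 * d 0) *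
          (P 0 2 * P 1 0 * P 2 1) := by rw [h01, h12, h20]; ring
    _ = (c 0 * P 0 2 * d 2) * (c 1 * P 1 0 * d 0) * (c 2 * P 2 1 * d 1) *
          (P 0 1 * P 1 2 * P 2 0) := by ring
    _ = P 0 1 * P 1 2 * P 2 0 := by rw [h02, h10, h21]; ring

theorem stmt_1 (P : Matrix (Fin 3) (Fin 3) ℝ) (hP : IsPosCounterDiag P)
    (c d c' d' : Fin 3 → ℝ)
    (hc : ∀ i, c i ≠ 0) (hd : ∀ i, d i ≠ 0)
    (hc' : ∀ i, c' i ≠ 0) (hd' : ∀ i, d' i ≠ 0)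
    (f f' : ℝ) (hf : 0 < f) (hf' : 0 < f')
    (h : Matrix.diagonal c * P * Matrix.diagonal d = stdTrigonal f)
    (h' : Matrix.diagonal c' * P * Matrix.diagonal d' = stdTrigonal f') :
    f = f' := by
  have hQ : P 0 2 * P 1 0 * P 2 1 ≠ 0 :=
    (mul_pos (mul_pos (hP.2 0 2 (by decide)) (hP.2 1 0 (by decide)))
      (hP.2 2 1 (by decide))).ne'
  have hcube : f ^ 3 = f' ^ 3 := mul_right_cancel₀ hQ
    ((pow_three_mul_eq_of_diagonal_mul_mul_diagonal h).trans
      (pow_three_mul_eq_of_diagonal_mul_mul_diagonal h').symm)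
  exact (pow_left_inj₀ hf.le hf'.le three_ne_zero).mp hcube
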